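/- arXiv:0812.4807 — 2 statements merged into one kernel-verified Lean document; each statement's English description precedes it below -/
import Mathlib

section
/- Let M be a field of characteristic not 2 and a, b in M with b(a^2 - 4b) ≠ 0. Assume f(X) = X^4 + aX^2 + b is irreducible over M. Then: (i) Gal(f/M) ≅ V_4 (Klein four) if and only if b is a square in M; (ii) Gal(f/M) ≅ C_4 (cyclic of order 4) if and only if (a^2-4b)/b is a square in M; (iii) Gal(f/M) ≅ D_4 (dihedral of order 8) if and only if neither b nor (a^2-4b)/b is a square in M. -/
open Polynomial

/-- The homomorphism out of a dihedral group given by a rotation `ρ` and a reflection `κ`. -/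
def DihedralGroup.liftOfRelations {G : Type*} [Group G] {n : ℕ} (ρ κ : G) (hρ : ρ ^ n = 1)
    (hκ : κ * κ = 1) (hκρ : κ * ρ * κ = ρ⁻¹) : DihedralGroup n →* G :=
  let P : ZMod n →+ Additive G :=
    ZMod.lift n ⟨zmultiplesHom _ (Additive.ofMul ρ), by
      simpa [← ofMul_pow] using hρ⟩
  have hinv : κ⁻¹ = κ := inv_eq_of_mul_eq_one_left hκ
  have hP : ∀ i, (P i).toMul * κ = κ * (P (-i)).toMul := by
    intro i
    obtain ⟨k, rfl⟩ := ZMod.intCast_surjective i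
    have hconj : κ * ρ ^ k * κ⁻¹ = (κ * ρ * κ⁻¹) ^ k := (conj_zpow).symm
    rw [hinv, hκρ] at hconj
    have hk : (P (k : ZMod n)).toMul = ρ ^ k := by simp [P]
    rw [map_neg, toMul_neg, hk, ← inv_zpow, ← hconj, mul_assoc κ, ← mul_assoc κ κ, hκ, one_mul]
  { toFun
      | .r i => (P i).toMul
      | .sr i => κ * (P i).toMul
    map_one' := congrArg Additive.toMul (map_zero P)
    map_mul' := by
      rintro (i | i) (j | j)
      · simp
      · simp only [DihedralGroup.r_mul_sr]
        rw [← mul_assoc, hP, mul_assoc, ← toMul_add, ← map_add, neg_add_eq_sub]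
      · simp [mul_assoc]
      · simp only [DihedralGroup.sr_mul_sr]
        rw [mul_assoc, ← mul_assoc _ κ, hP, mul_assoc, ← mul_assoc κ κ, hκ, one_mul,
          ← toMul_add, ← map_add, neg_add_eq_sub] }

theorem DihedralGroup.liftOfRelations_r_natCast {G : Type*} [Group G] {n : ℕ} (ρ κ : G)
    (hρ : ρ ^ n = 1) (hκ : κ * κ = 1) (hκρ : κ * ρ * κ = ρ⁻¹) (k : ℕ) :
    liftOfRelations ρ κ hρ hκ hκρ (.r k) = ρ ^ k := by
  have := ZMod.lift_coe n ⟨zmultiplesHom _ (Additive.ofMul ρ), by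
      simpa [← ofMul_pow] using hρ⟩ (k : ℤ)
  rw [Int.cast_natCast] at this
  exact (congrArg Additive.toMul this).trans (by simp)

theorem DihedralGroup.liftOfRelations_sr_natCast {G : Type*} [Group G] {n : ℕ} (ρ κ : G)
    (hρ : ρ ^ n = 1) (hκ : κ * κ = 1) (hκρ : κ * ρ * κ = ρ⁻¹) (k : ℕ) :
    liftOfRelations ρ κ hρ hκ hκρ (.sr k) = κ * ρ ^ k := by
  rw [← liftOfRelations_r_natCast ρ κ hρ hκ hκρ]
  rfl

section BiquadraticRoots

variable {M L : Type*} [Field M] [Field L] [Algebra M L] {a b : M} {α β : L}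

theorem biquadratic_algEquiv_cases (hsum : α ^ 2 + β ^ 2 = algebraMap M L (-a))
    (hprod : (α * β) ^ 2 = algebraMap M L b) (σ : Gal(L/M)) :
    (σ α = α ∨ σ α = -α) ∧ (σ β = β ∨ σ β = -β) ∨
      (σ α = β ∨ σ α = -β) ∧ (σ β = α ∨ σ β = -α) := by
  have h1 := congrArg σ hsum
  have h2 := congrArg σ hprod
  rw [AlgEquiv.commutes, ← hsum] at h1
  rw [AlgEquiv.commutes, ← hprod] at h2
  simp only [map_add, map_pow, map_mul] at h1 h2
  have h3 : (σ α ^ 2 - α ^ 2) * (σ α ^ 2 - β ^ 2) = 0 := by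
    linear_combination σ α ^ 2 * h1 - h2
  rcases mul_eq_zero.mp h3 with h | h
  · exact .inl ⟨sq_eq_sq_iff_eq_or_eq_neg.mp (by linear_combination h),
      sq_eq_sq_iff_eq_or_eq_neg.mp (by linear_combination h1 - h)⟩
  · exact .inr ⟨sq_eq_sq_iff_eq_or_eq_neg.mp (by linear_combination h),
      sq_eq_sq_iff_eq_or_eq_neg.mp (by linear_combination h1 - h)⟩

theorem biquadratic_klein (h2 : (2 : L) ≠ 0) (hα : α ≠ 0) (hβ : β ≠ 0) (hαβ : α ^ 2 ≠ β ^ 2)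
    (hsum : α ^ 2 + β ^ 2 = algebraMap M L (-a)) (hprod : (α * β) ^ 2 = algebraMap M L b)
    (hext : ∀ σ τ : Gal(L/M), σ α = τ α → σ β = τ β → σ = τ)
    {τ ρ : Gal(L/M)} (hτ : τ α = β) (hρ : ρ α = -α) (hb : IsSquare b) :
    IsKleinFour Gal(L/M) := by
  have hfix (σ : Gal(L/M)) : σ α * σ β = α * β := by
    obtain ⟨c, rfl⟩ := hb
    have h : α * β = algebraMap M L c ∨ α * β = algebraMap M L (-c) := by
      rw [map_neg]
      exact sq_eq_sq_iff_eq_or_eq_neg.mp (by rw [hprod, map_mul, sq])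
    rw [← map_mul]
    rcases h with h | h <;> rw [h, AlgEquiv.commutes]
  have hα2 : α ≠ -α := fun h ↦ hα (by simpa [h2] using (by linear_combination h : 2 * α = 0))
  have hne : α ≠ β := fun h ↦ hαβ (by rw [h])
  have hne' : α ≠ -β := fun h ↦ hαβ (by rw [h, neg_sq])
  have hdet (σ σ' : Gal(L/M)) (h : σ α = σ' α) : σ = σ' := by
    refine hext _ _ h (mul_left_cancel₀ (a := σ α) (by simpa using hα) ?_)
    rw [hfix, h, hfix]
  have hval (σ : Gal(L/M)) := biquadratic_algEquiv_cases hsum hprod σ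
  have hsq (σ : Gal(L/M)) : σ * σ = 1 := by
    refine hdet _ _ ?_
    have := hfix σ
    rw [AlgEquiv.mul_apply, AlgEquiv.one_apply]
    rcases hval σ with ⟨h | h, -⟩ | ⟨h | h, h' | h'⟩
    · simp [h]
    · simp [h]
    · rw [h, h']
    · rw [h, h'] at this
      exact absurd (by linear_combination -this) (mul_ne_zero h2 (mul_ne_zero hα hβ))
    · rw [h, h'] at this
      exact absurd (by linear_combination -this) (mul_ne_zero h2 (mul_ne_zero hα hβ))
    · simp [h, h']
  have hcard : Nat.card Gal(L/M) = 4 := by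
    rw [← Nat.card_fin 4]
    refine (Nat.card_eq_of_bijective ![1, τ, ρ, τ * ρ] ⟨fun i j hij ↦ ?_, fun σ ↦ ?_⟩).symm
    · have h := congrArg (· α) hij
      fin_cases i <;> fin_cases j <;> simp [hτ, hρ] at h ⊢ <;> grind
    · rcases hval σ with ⟨h | h, -⟩ | ⟨h | h, -⟩
      · exact ⟨0, hdet _ _ (by simp [h])⟩
      · exact ⟨2, hdet _ _ (by simp [h, hρ])⟩
      · exact ⟨1, hdet _ _ (by simp [h, hτ])⟩
      · exact ⟨3, hdet _ _ (by simp [h, hρ, hτ])⟩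
  refine ⟨hcard, ?_⟩
  have hexp : Monoid.exponent Gal(L/M) ∣ 2 :=
    Monoid.exponent_dvd_of_forall_pow_eq_one fun σ ↦ by rw [sq, hsq]
  refine ((Nat.dvd_prime Nat.prime_two).mp hexp).resolve_left fun h1 ↦ ?_
  have := Monoid.exp_eq_one_iff.mp h1
  rw [Nat.card_of_subsingleton (1 : Gal(L/M))] at hcard
  omega

theorem biquadratic_cyclic (h2 : (2 : L) ≠ 0) (hα : α ≠ 0) (hβ : β ≠ 0) (hαβ : α ^ 2 ≠ β ^ 2)
    (hsum : α ^ 2 + β ^ 2 = algebraMap M L (-a)) (hprod : (α * β) ^ 2 = algebraMap M L b)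
    (hext : ∀ σ τ : Gal(L/M), σ α = τ α → σ β = τ β → σ = τ)
    {τ : Gal(L/M)} (hτ : τ α = β) (hb : IsSquare ((a ^ 2 - 4 * b) / b)) :
    IsCyclic Gal(L/M) ∧ Nat.card Gal(L/M) = 4 := by
  have hδ : α * β ≠ 0 := mul_ne_zero hα hβ
  have hfix (σ : Gal(L/M)) :
      (σ α ^ 2 - σ β ^ 2) * (α * β) = (α ^ 2 - β ^ 2) * (σ α * σ β) := by
    obtain ⟨c, hc⟩ := hb
    have hc' : ((α ^ 2 - β ^ 2) / (α * β)) ^ 2 = algebraMap M L c ^ 2 := by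
      have h := congrArg (algebraMap M L) hc
      have ha : algebraMap M L a = -(α ^ 2 + β ^ 2) := by rw [hsum, map_neg, neg_neg]
      rw [map_div₀, map_sub, map_mul, map_mul, map_pow, ← hprod, ha, map_ofNat] at h
      rw [div_pow, sq (algebraMap M L c), ← h]
      ring
    have h : (α ^ 2 - β ^ 2) / (α * β) = algebraMap M L c ∨
        (α ^ 2 - β ^ 2) / (α * β) = algebraMap M L (-c) := by
      rw [map_neg]
      exact sq_eq_sq_iff_eq_or_eq_neg.mp hc'
    have hσ : σ ((α ^ 2 - β ^ 2) / (α * β)) = (α ^ 2 - β ^ 2) / (α * β) := by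
      rcases h with h | h <;> rw [h, AlgEquiv.commutes]
    simp only [map_div₀, map_sub, map_mul, map_pow] at hσ
    rwa [div_eq_div_iff (by simp [hα, hβ]) hδ] at hσ
  have hε : α ^ 2 - β ^ 2 ≠ 0 := sub_ne_zero.mpr hαβ
  have hnz : 2 * ((α ^ 2 - β ^ 2) * (α * β)) ≠ 0 := mul_ne_zero h2 (mul_ne_zero hε hδ)
  have hval (σ : Gal(L/M)) := biquadratic_algEquiv_cases hsum hprod σ
  have hα2 : α ≠ -α := fun h ↦ hα (by simpa [h2] using (by linear_combination h : 2 * α = 0))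
  have hdet (σ σ' : Gal(L/M)) (h : σ α = σ' α) : σ = σ' := by
    refine hext _ _ h ?_
    have h1 := hfix σ
    have h1' := hfix σ'
    rcases hval σ with ⟨hs | hs, ht | ht⟩ | ⟨hs | hs, ht | ht⟩ <;>
      rcases hval σ' with ⟨hs' | hs', ht' | ht'⟩ | ⟨hs' | hs', ht' | ht'⟩ <;> grind
  have hτβ : τ β = -α := by
    have := hfix τ
    rcases hval τ with ⟨hs | hs, ht | ht⟩ | ⟨-, ht | ht⟩ <;> grind
  have hτ2 : (τ ^ 2) α = -α := by simp [sq, hτ, hτβ]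
  have hτ4 : τ ^ 4 = 1 := hdet _ _ (by simp [pow_succ, hτ, hτβ])
  have hord : orderOf τ = 2 ^ (1 + 1) := by
    refine orderOf_eq_prime_pow (fun h ↦ hα2 ?_) hτ4
    have h : τ ^ 2 = 1 := h
    rw [← hτ2, h, AlgEquiv.one_apply]
  have hgen (σ : Gal(L/M)) : σ ∈ Subgroup.zpowers τ := by
    rw [Subgroup.mem_zpowers_iff]
    rcases hval σ with ⟨h | h, -⟩ | ⟨h | h, -⟩
    · exact ⟨0, hdet _ _ (by simp [h])⟩
    · exact ⟨2, hdet _ _ (by rw [h]; exact hτ2)⟩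
    · exact ⟨1, hdet _ _ (by simp [h, hτ])⟩
    · refine ⟨3, hdet _ _ ?_⟩
      rw [h]
      simp [pow_succ, hτ, hτβ]
  exact ⟨⟨τ, hgen⟩, by rw [← orderOf_eq_card_of_forall_mem_zpowers hgen, hord]; rfl⟩

theorem biquadratic_dihedral [FiniteDimensional M L] [IsGalois M L]
    (h2 : (2 : L) ≠ 0) (hα : α ≠ 0) (hβ : β ≠ 0) (hαβ : α ^ 2 ≠ β ^ 2)
    (hsum : α ^ 2 + β ^ 2 = algebraMap M L (-a)) (hprod : (α * β) ^ 2 = algebraMap M L b)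
    (hext : ∀ σ τ : Gal(L/M), σ α = τ α → σ β = τ β → σ = τ)
    {τ : Gal(L/M)} (hτ : τ α = β) (hb : ¬ IsSquare b)
    (hb' : ¬ IsSquare ((a ^ 2 - 4 * b) / b)) :
    Nonempty (Gal(L/M) ≃* DihedralGroup 4) := by
  have hδ : α * β ≠ 0 := mul_ne_zero hα hβ
  have hα2 : α ≠ -α := fun h ↦ hα (by simpa [h2] using (by linear_combination h : 2 * α = 0))
  have hβ2 : β ≠ -β := fun h ↦ hβ (by simpa [h2] using (by linear_combination h : 2 * β = 0))
  have hne : α ≠ β := fun h ↦ hαβ (by rw [h])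
  have hne' : α ≠ -β := fun h ↦ hαβ (by rw [h, neg_sq])
  have hval (σ : Gal(L/M)) := biquadratic_algEquiv_cases hsum hprod σ
  have hsq_of_fixed {x : L} {y : M} (hxy : x ^ 2 = algebraMap M L y)
      (hx : ∀ σ : Gal(L/M), σ x = x) : IsSquare y := by
    obtain ⟨c, rfl⟩ := (IsGalois.mem_range_algebraMap_iff_fixed x).mpr hx
    exact ⟨c, (algebraMap M L).injective (by rw [← hxy, map_mul, sq])⟩
  have h_prod : ∃ σ : Gal(L/M), σ α * σ β ≠ α * β := by
    by_contra! h
    exact hb (hsq_of_fixed hprod fun σ ↦ by rw [map_mul, h])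
  have h_ratio : ∃ σ : Gal(L/M),
      (σ α ^ 2 - σ β ^ 2) * (α * β) ≠ (α ^ 2 - β ^ 2) * (σ α * σ β) := by
    by_contra! h
    refine hb' (hsq_of_fixed (x := (α ^ 2 - β ^ 2) / (α * β)) ?_ fun σ ↦ ?_)
    · have ha : algebraMap M L a = -(α ^ 2 + β ^ 2) := by rw [hsum, map_neg, neg_neg]
      rw [map_div₀, map_sub, map_mul, map_pow, ← hprod, ha, map_ofNat, div_pow]
      ring
    · simp only [map_div₀, map_sub, map_mul, map_pow]
      rw [div_eq_div_iff (by simp [hα, hβ]) hδ, h]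
  have hflip : ∃ σ : Gal(L/M), (σ α = α ∧ σ β = -β) ∨ (σ α = -α ∧ σ β = β) := by
    obtain ⟨σ, hσ⟩ := h_prod
    obtain ⟨σ', hσ'⟩ := h_ratio
    have hswap (h : (σ α = β ∧ σ β = -α) ∨ (σ α = -β ∧ σ β = α)) :
        ∃ σ : Gal(L/M), (σ α = α ∧ σ β = -β) ∨ (σ α = -α ∧ σ β = β) := by
      rcases hval σ' with ⟨hs' | hs', ht' | ht'⟩ | ⟨hs' | hs', ht' | ht'⟩
      · exact absurd (by rw [hs', ht']) hσ'
      · exact ⟨σ', .inl ⟨hs', ht'⟩⟩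
      · exact ⟨σ', .inr ⟨hs', ht'⟩⟩
      · exact absurd (by rw [hs', ht']; ring) hσ'
      · exact ⟨σ * σ', by rcases h with ⟨hs, ht⟩ | ⟨hs, ht⟩ <;> simp [hs, ht, hs', ht']⟩
      · exact absurd (by rw [hs', ht']; ring) hσ'
      · exact absurd (by rw [hs', ht']; ring) hσ'
      · exact ⟨σ * σ', by rcases h with ⟨hs, ht⟩ | ⟨hs, ht⟩ <;> simp [hs, ht, hs', ht']⟩
    rcases hval σ with ⟨hs | hs, ht | ht⟩ | ⟨hs | hs, ht | ht⟩
    · simp [hs, ht] at hσ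
    · exact ⟨σ, .inl ⟨hs, ht⟩⟩
    · exact ⟨σ, .inr ⟨hs, ht⟩⟩
    · simp [hs, ht] at hσ
    · simp [hs, ht, mul_comm] at hσ
    · exact hswap (.inl ⟨hs, ht⟩)
    · exact hswap (.inr ⟨hs, ht⟩)
    · simp [hs, ht, mul_comm] at hσ
  have hτβ : τ β = α ∨ τ β = -α := by
    have := hval τ
    grind
  have hκ : ∃ κ : Gal(L/M), κ α = α ∧ κ β = -β := by
    obtain ⟨σ, h | ⟨h, h'⟩⟩ := hflip
    · exact ⟨σ, h⟩
    · rcases hτβ with ht | ht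
      · exact ⟨τ * σ * τ, by simp [hτ, ht, h, h']⟩
      · exact ⟨τ * σ * τ * τ * τ, by simp [hτ, ht, h, h']⟩
  obtain ⟨κ, hκα, hκβ⟩ := hκ
  have hρ : ∃ ρ : Gal(L/M), ρ α = β ∧ ρ β = -α := by
    rcases hτβ with ht | ht
    · exact ⟨τ * κ, by simp [hτ, ht, hκα, hκβ]⟩
    · exact ⟨τ, hτ, ht⟩
  obtain ⟨ρ, hρα, hρβ⟩ := hρ
  have hρ4 : ρ ^ 4 = 1 := hext _ _ (by simp [pow_succ, hρα, hρβ]) (by simp [pow_succ, hρα, hρβ])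
  have hκ2 : κ * κ = 1 := hext _ _ (by simp [hκα]) (by simp [hκβ])
  have hκρ : κ * ρ * κ = ρ⁻¹ := by
    rw [eq_inv_iff_mul_eq_one]
    exact hext _ _ (by simp [hρα, hρβ, hκα, hκβ]) (by simp [hρα, hρβ, hκα, hκβ])
  let φ : DihedralGroup 4 →* Gal(L/M) := DihedralGroup.liftOfRelations ρ κ hρ4 hκ2 hκρ
  have hφr (k : ℕ) : φ (.r k) = ρ ^ k := DihedralGroup.liftOfRelations_r_natCast ..
  have hφsr (k : ℕ) : φ (.sr k) = κ * ρ ^ k := DihedralGroup.liftOfRelations_sr_natCast ..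
  refine ⟨(MulEquiv.ofBijective φ ⟨?_, fun σ ↦ ?_⟩).symm⟩
  · rw [injective_iff_map_eq_one]
    have hlt (i : ZMod 4) : ∃ k : ℕ, k < 4 ∧ (k : ZMod 4) = i := ⟨i.val, i.val_lt, by simp⟩
    rintro (i | i) hi <;> obtain ⟨k, hk, rfl⟩ := hlt i <;>
      simp only [hφr, hφsr] at hi <;>
      have h := congrArg (· α) hi <;> have h' := congrArg (· β) hi <;>
      interval_cases k <;> simp [pow_succ, hρα, hρβ, hκα, hκβ] at h h' ⊢ <;> grind
  · rcases hval σ with ⟨hs | hs, ht | ht⟩ | ⟨hs | hs, ht | ht⟩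
    · exact ⟨.r (0 : ℕ), by rw [hφr]; apply hext <;> simp [*]⟩
    · exact ⟨.sr (0 : ℕ), by rw [hφsr]; apply hext <;> simp [*]⟩
    · exact ⟨.sr (2 : ℕ), by rw [hφsr]; apply hext <;> simp [pow_succ, *]⟩
    · exact ⟨.r (2 : ℕ), by rw [hφr]; apply hext <;> simp [pow_succ, *]⟩
    · exact ⟨.sr (3 : ℕ), by rw [hφsr]; apply hext <;> simp [pow_succ, *]⟩
    · exact ⟨.r (1 : ℕ), by rw [hφr]; apply hext <;> simp [pow_succ, *]⟩
    · exact ⟨.r (3 : ℕ), by rw [hφr]; apply hext <;> simp [pow_succ, *]⟩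
    · exact ⟨.sr (1 : ℕ), by rw [hφsr]; apply hext <;> simp [pow_succ, *]⟩

end BiquadraticRoots

theorem biquadratic_separable {M : Type*} [Field M] (h2 : (2 : M) ≠ 0) {a b : M}
    (hirr : Irreducible (X ^ 4 + C a * X ^ 2 + C b : M[X])) :
    (X ^ 4 + C a * X ^ 2 + C b : M[X]).Separable := by
  rw [separable_iff_derivative_ne_zero hirr]
  intro h
  have h3 := congrArg (coeff · 3) h
  simp only [coeff_derivative, coeff_add, coeff_C_mul, coeff_X_pow, coeff_C, coeff_zero] at h3
  norm_num at h3
  exact mul_ne_zero h2 h2 (by linear_combination h3)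

/-- Galois group of an irreducible separable biquadratic `f = X⁴+aX²+b`:
it is `V₄` iff `b` is a square, `C₄` iff `(a²-4b)/b` is a square, and `D₄`
iff neither is a square. -/
theorem biquadratic_galois_group {M : Type*} [Field M] (h2 : (2 : M) ≠ 0)
    (a b : M) (hb : b * (a ^ 2 - 4 * b) ≠ 0)
    (hirr : Irreducible (X ^ 4 + C a * X ^ 2 + C b : M[X])) :
    (Nonempty ((X ^ 4 + C a * X ^ 2 + C b : M[X]).Gal ≃*
        Multiplicative (ZMod 2 × ZMod 2)) ↔ IsSquare b) ∧
    (Nonempty ((X ^ 4 + C a * X ^ 2 + C b : M[X]).Gal ≃*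
        Multiplicative (ZMod 4)) ↔ IsSquare ((a ^ 2 - 4 * b) / b)) ∧
    (Nonempty ((X ^ 4 + C a * X ^ 2 + C b : M[X]).Gal ≃* DihedralGroup 4) ↔
      ¬ IsSquare b ∧ ¬ IsSquare ((a ^ 2 - 4 * b) / b)) := by
  have hsep := biquadratic_separable h2 hirr
  set f : M[X] := X ^ 4 + C a * X ^ 2 + C b with hf
  let L := f.SplittingField
  have : IsGalois M L := .of_separable_splitting_field hsep
  have hsplits : (f.map (algebraMap M L)).Splits := SplittingField.splits f
  have hroot (x : L) : x ∈ f.rootSet L ↔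
      x ^ 4 + algebraMap M L a * x ^ 2 + algebraMap M L b = 0 := by
    rw [mem_rootSet_of_ne hirr.ne_zero]
    simp [hf]
  obtain ⟨α, hα⟩ : ∃ α : L, α ^ 4 + algebraMap M L a * α ^ 2 + algebraMap M L b = 0 := by
    obtain ⟨α, hα⟩ := hsplits.exists_eval_eq_zero
      (by rw [degree_map]; exact hirr.degree_pos.ne')
    exact ⟨α, by simpa [hf] using hα⟩
  obtain ⟨β, hβ⟩ : ∃ β : L, β ^ 2 + (algebraMap M L a + α ^ 2) = 0 := by
    have hg : (X ^ 2 + C (algebraMap M L a + α ^ 2)).Splits :=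
      hsplits.of_dvd (map_ne_zero hirr.ne_zero) ⟨X ^ 2 - C (α ^ 2), by
        have hb' : algebraMap M L b = -(α ^ 4 + algebraMap M L a * α ^ 2) := by
          linear_combination hα
        simp only [hf, Polynomial.map_add, Polynomial.map_mul, Polynomial.map_pow, map_X, map_C,
          hb', map_add, map_neg, map_mul, map_pow]
        ring⟩
    obtain ⟨β, hβ⟩ := hg.exists_eval_eq_zero (by rw [degree_X_pow_add_C two_pos]; decide)
    exact ⟨β, by simpa using hβ⟩
  have hsum : α ^ 2 + β ^ 2 = algebraMap M L (-a) := by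
    rw [map_neg]; linear_combination hβ
  have hprod : (α * β) ^ 2 = algebraMap M L b := by
    linear_combination α ^ 2 * hβ - hα
  have hinj := FaithfulSMul.algebraMap_injective M L
  have h2L : (2 : L) ≠ 0 := by
    rw [← map_ofNat (algebraMap M L) 2]
    exact (map_ne_zero_iff _ hinj).mpr h2
  have hαβ0 : α * β ≠ 0 := by
    intro h
    rw [h, zero_pow two_ne_zero, eq_comm, map_eq_zero_iff _ hinj] at hprod
    simp [hprod] at hb
  have hα0 := left_ne_zero_of_mul hαβ0
  have hβ0 := right_ne_zero_of_mul hαβ0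
  have hαβ : α ^ 2 ≠ β ^ 2 := by
    intro h
    refine hb (mul_eq_zero_of_right _ ((map_eq_zero_iff _ hinj).mp ?_))
    rw [map_sub, map_mul, map_pow, map_ofNat, ← hprod, ← neg_sq, ← map_neg, ← hsum]
    linear_combination (α ^ 2 - β ^ 2) * h
  have hext (σ τ : Gal(L/M)) (h : σ α = τ α) (h' : σ β = τ β) : σ = τ := by
    refine Gal.ext f fun x hx ↦ show (σ : L → L) x = (τ : L → L) x from ?_
    have hx' : (x ^ 2 - α ^ 2) * (x ^ 2 - β ^ 2) = 0 := by
      linear_combination (hroot x).mp hx - x ^ 2 * hβ + α ^ 2 * hβ - hα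
    rcases mul_eq_zero.mp hx' with h0 | h0 <;>
      rcases sq_eq_sq_iff_eq_or_eq_neg.mp (sub_eq_zero.mp h0) with rfl | rfl <;>
      simp only [map_neg, h, h']
  have hconj (x : L) (hx : x ∈ f.rootSet L) : ∃ σ : Gal(L/M), σ α = x := by
    have hmin {y : L} (hy : y ∈ f.rootSet L) :=
      minpoly.eq_of_irreducible hirr (aeval_eq_zero_of_mem_rootSet hy)
    exact (Normal.minpoly_eq_iff_mem_orbit L).mp
      ((hmin hx).symm.trans (hmin ((hroot α).mpr hα)))
  obtain ⟨τ, hτ⟩ := hconj β ((hroot β).mpr (by linear_combination (β ^ 2 - α ^ 2) * hβ + hα))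
  obtain ⟨ρ, hρ⟩ := hconj (-α) ((hroot _).mpr (by linear_combination hα))
  have hV (h : IsSquare b) : Nonempty (f.Gal ≃* Multiplicative (ZMod 2 × ZMod 2)) := by
    have := biquadratic_klein h2L hα0 hβ0 hαβ hsum hprod hext hτ hρ h
    exact IsKleinFour.nonempty_mulEquiv (G₁ := Gal(L/M))
  have hC (h : IsSquare ((a ^ 2 - 4 * b) / b)) : Nonempty (f.Gal ≃* Multiplicative (ZMod 4)) := by
    obtain ⟨hcyc, hcard⟩ := biquadratic_cyclic h2L hα0 hβ0 hαβ hsum hprod hext hτ h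
    exact ⟨mulEquivOfCyclicCardEq (G := Gal(L/M)) (by
      simp only [hcard, Nat.card_eq_fintype_card, Fintype.card_multiplicative, ZMod.card])⟩
  have hD (h : ¬ IsSquare b) (h' : ¬ IsSquare ((a ^ 2 - 4 * b) / b)) :
      Nonempty (f.Gal ≃* DihedralGroup 4) :=
    biquadratic_dihedral h2L hα0 hβ0 hαβ hsum hprod hext hτ h h'
  have hVC (e : f.Gal ≃* Multiplicative (ZMod 2 × ZMod 2))
      (e' : f.Gal ≃* Multiplicative (ZMod 4)) : False :=
    IsKleinFour.not_isCyclic (isCyclic_of_surjective (e'.symm.trans e) (MulEquiv.surjective _))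
  have hVD (e : f.Gal ≃* Multiplicative (ZMod 2 × ZMod 2)) (e' : f.Gal ≃* DihedralGroup 4) :
      False := by
    have := Nat.card_congr (e.symm.trans e').toEquiv
    rw [DihedralGroup.nat_card] at this
    simp at this
  have hCD (e : f.Gal ≃* Multiplicative (ZMod 4)) (e' : f.Gal ≃* DihedralGroup 4) : False := by
    have := Nat.card_congr (e.symm.trans e').toEquiv
    rw [DihedralGroup.nat_card] at this
    simp at this
  refine ⟨⟨fun ⟨e⟩ ↦ ?_, hV⟩, ⟨fun ⟨e⟩ ↦ ?_, hC⟩,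
    ⟨fun ⟨e⟩ ↦ ⟨fun h ↦ ?_, fun h ↦ ?_⟩, fun h ↦ hD h.1 h.2⟩⟩
  · by_contra h
    by_cases h' : IsSquare ((a ^ 2 - 4 * b) / b)
    · exact (hC h').elim (hVC e)
    · exact (hD h h').elim (hVD e)
  · by_contra h
    by_cases h' : IsSquare b
    · exact (hV h').elim fun e' ↦ hVC e' e
    · exact (hD h' h).elim (hCD e)
  · exact (hV h).elim fun e' ↦ hVD e' e
  · exact (hC h).elim fun e' ↦ hCD e' e
end

section
/- For any field M of characteristic not 2 and a, b in M, the splitting field over M of X^4 + aX^2 + b equals the splitting field over M of X^4 + 2aX^2 + (a^2 - 4b). -/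
open Polynomial

/-- If `α², β²` are the roots of `Y² + aY + b`, then the roots of the biquadratic
`X⁴ + aX² + b` generate the same field as `α` and `β`. -/
theorem adjoin_rootSet_biquadratic {M E : Type*} [Field M] [Field E] [Algebra M E]
    (a b : M) (α β : E) (hadd : α ^ 2 + β ^ 2 = -algebraMap M E a)
    (hmul : α ^ 2 * β ^ 2 = algebraMap M E b) :
    IntermediateField.adjoin M ((X ^ 4 + C a * X ^ 2 + C b : M[X]).rootSet E) =
      IntermediateField.adjoin M {α, β} := by
  have hp : (X ^ 4 + C a * X ^ 2 + C b : M[X]) ≠ 0 := by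
    apply Monic.ne_zero
    monicity!
  have hroot (x : E) : x ∈ (X ^ 4 + C a * X ^ 2 + C b : M[X]).rootSet E ↔
      (x - α) * (x + α) * ((x - β) * (x + β)) = 0 := by
    have haeval : aeval x (X ^ 4 + C a * X ^ 2 + C b : M[X]) =
        (x - α) * (x + α) * ((x - β) * (x + β)) := by
      simp only [map_add, map_mul, map_pow, aeval_X, aeval_C]
      linear_combination x ^ 2 * hadd - hmul
    rw [mem_rootSet, haeval, and_iff_right hp]
  apply le_antisymm
  · rw [IntermediateField.adjoin_le_iff]
    intro x hx
    have hα : α ∈ IntermediateField.adjoin M {α, β} :=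
      IntermediateField.subset_adjoin M _ (by simp)
    have hβ : β ∈ IntermediateField.adjoin M {α, β} :=
      IntermediateField.subset_adjoin M _ (by simp)
    simp only [hroot, mul_eq_zero, sub_eq_zero, add_eq_zero_iff_eq_neg] at hx
    rcases hx with (rfl | rfl) | (rfl | rfl)
    exacts [hα, neg_mem hα, hβ, neg_mem hβ]
  · apply IntermediateField.adjoin.mono
    rintro x (rfl | rfl) <;> simp [hroot]

/-- In characteristic different from `2`, the sum and difference of two elements generate the
same field as the elements themselves. -/
theorem adjoin_pair_add_sub {M E : Type*} [Field M] [Field E] [Algebra M E]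
    (h2 : (2 : E) ≠ 0) (α β : E) :
    IntermediateField.adjoin M {α + β, α - β} = IntermediateField.adjoin M {α, β} := by
  apply le_antisymm <;> rw [IntermediateField.adjoin_le_iff]
  · have hα : α ∈ IntermediateField.adjoin M {α, β} :=
      IntermediateField.subset_adjoin M _ (by simp)
    have hβ : β ∈ IntermediateField.adjoin M {α, β} :=
      IntermediateField.subset_adjoin M _ (by simp)
    rintro x (rfl | rfl)
    exacts [add_mem hα hβ, sub_mem hα hβ]
  · have hs : α + β ∈ IntermediateField.adjoin M {α + β, α - β} :=
      IntermediateField.subset_adjoin M _ (by simp)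
    have hd : α - β ∈ IntermediateField.adjoin M {α + β, α - β} :=
      IntermediateField.subset_adjoin M _ (by simp)
    have htwo : (2 : E) ∈ IntermediateField.adjoin M {α + β, α - β} := ofNat_mem _ 2
    have hα : α = (α + β + (α - β)) / 2 := by field_simp; ring
    have hβ : β = (α + β - (α - β)) / 2 := by field_simp; ring
    rintro x (hx | hx) <;> rw [hx]
    · exact (congrArg (· ∈ IntermediateField.adjoin M {α + β, α - β}) hα).mpr
        (div_mem (add_mem hs hd) htwo)
    · exact (congrArg (· ∈ IntermediateField.adjoin M {α + β, α - β}) hβ).mpr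
        (div_mem (sub_mem hs hd) htwo)

/-- Over a field of characteristic ≠ 2, `X⁴+aX²+b` and `X⁴+2aX²+(a²-4b)` have the
same splitting field (inside an algebraic closure). -/
theorem biquadratic_dual_splitting_field {M : Type*} [Field M] (h2 : (2 : M) ≠ 0)
    (a b : M) :
    IntermediateField.adjoin M
        ((X ^ 4 + C a * X ^ 2 + C b : M[X]).rootSet (AlgebraicClosure M)) =
      IntermediateField.adjoin M
        ((X ^ 4 + C (2 * a) * X ^ 2 + C (a ^ 2 - 4 * b) : M[X]).rootSet
          (AlgebraicClosure M)) := by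
  have h2' : (2 : AlgebraicClosure M) ≠ 0 := by
    rw [← map_ofNat (algebraMap M (AlgebraicClosure M)) 2]
    exact (_root_.map_ne_zero _).mpr h2
  set a' := algebraMap M (AlgebraicClosure M) a with ha
  set b' := algebraMap M (AlgebraicClosure M) b with hb
  obtain ⟨s, hs⟩ := IsAlgClosed.exists_pow_nat_eq (a' ^ 2 - 4 * b') two_pos
  obtain ⟨α, hα⟩ := IsAlgClosed.exists_pow_nat_eq ((-a' + s) / 2) two_pos
  obtain ⟨β, hβ⟩ := IsAlgClosed.exists_pow_nat_eq ((-a' - s) / 2) two_pos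
  have hadd : α ^ 2 + β ^ 2 = -a' := by
    rw [hα, hβ]
    field_simp
    ring
  have hmul : α ^ 2 * β ^ 2 = b' := by
    have h4 : (4 : AlgebraicClosure M) ≠ 0 := by
      convert mul_ne_zero h2' h2' using 1
      norm_num
    have hα2 : 2 * α ^ 2 = -a' + s := by rw [hα]; field_simp
    have hβ2 : 2 * β ^ 2 = -a' - s := by rw [hβ]; field_simp
    apply mul_left_cancel₀ h4
    linear_combination 2 * β ^ 2 * hα2 + (-a' + s) * hβ2 - hs
  rw [adjoin_rootSet_biquadratic a b α β hadd hmul,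
    adjoin_rootSet_biquadratic (2 * a) (a ^ 2 - 4 * b) (α + β) (α - β) ?_ ?_,
    adjoin_pair_add_sub h2']
  · simp only [map_mul, map_ofNat, ← ha]
    linear_combination 2 * hadd
  · simp only [map_sub, map_mul, map_pow, map_ofNat, ← ha, ← hb]
    linear_combination (α ^ 2 + β ^ 2 - a') * hadd - 4 * hmul
end
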